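/- Let W ⊆ ℝ^n be a closed cone and let F ⊆ ℝ^n be the set of all nonnegative real combinations of finitely many fixed vectors c₁, …, c_l ∈ ℝ^n, each having all coordinates rational. Suppose there exists a linear functional φ₀ : ℝ^n → ℝ with φ₀(cᵢ) = 0 for all i and φ₀(w) > 0 for every w ∈ W \ {0}. Then there exists a linear functional φ : ℝ^n → ℝ taking rational values on the standard basis vectors, with φ(cᵢ) = 0 for all i and φ(w) > 0 for every w ∈ W \ {0}. -/

import Mathlib

theorem exists_generalized_inverse {l n : ℕ} (A : Matrix (Fin l) (Fin n) ℚ) :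
    ∃ B : Matrix (Fin n) (Fin l) ℚ, A * B * A = A := by
  obtain ⟨g, hg⟩ := A.toLin'.rangeRestrict.exists_rightInverse_of_surjective
    (LinearMap.range_rangeRestrict _)
  obtain ⟨B, hB⟩ := LinearMap.exists_extend g
  refine ⟨LinearMap.toMatrix' B, ?_⟩
  apply Matrix.toLin'.injective
  rw [Matrix.toLin'_mul, Matrix.toLin'_mul, Matrix.toLin'_toMatrix']
  apply LinearMap.ext
  intro v
  have h1 : B (A.toLin' v) = g (A.toLin'.rangeRestrict v) :=
    LinearMap.congr_fun hB (A.toLin'.rangeRestrict v)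
  have h2 := congrArg Subtype.val (LinearMap.congr_fun hg (A.toLin'.rangeRestrict v))
  simp only [LinearMap.comp_apply] at h2 ⊢
  rw [h1]
  exact h2

/-- **Existence of a rational supporting function.** Let `W ⊆ ℝ^n` be a closed cone and let
`F` be the set of nonnegative combinations of finitely many fixed rational vectors
`c 0, …, c (l-1)`. If there exists a linear functional `φ₀` vanishing on every `c i` and
strictly positive on `W \ {0}`, then there exists such a functional taking rational values
on the standard basis vectors. -/
theorem exists_rational_supporting_function (n l : ℕ) (W : Set (Fin n → ℝ))
    (hWclosed : IsClosed W)
    (hWcone : ∀ t : ℝ, 0 ≤ t → ∀ w ∈ W, t • w ∈ W)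
    (c : Fin l → Fin n → ℝ)
    (hc : ∀ i j, ∃ q : ℚ, c i j = (q : ℝ))
    (F : Set (Fin n → ℝ))
    (hF : F = {x | ∃ a : Fin l → ℝ, (∀ i, 0 ≤ a i) ∧ x = ∑ i, a i • c i})
    (φ₀ : (Fin n → ℝ) →ₗ[ℝ] ℝ)
    (hφ₀c : ∀ i, φ₀ (c i) = 0)
    (hφ₀W : ∀ w ∈ W, w ≠ 0 → 0 < φ₀ w) :
    ∃ φ : (Fin n → ℝ) →ₗ[ℝ] ℝ,
      (∀ j, ∃ q : ℚ, φ (Pi.single j 1) = (q : ℝ)) ∧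
      (∀ i, φ (c i) = 0) ∧
      (∀ w ∈ W, w ≠ 0 → 0 < φ w) := by
  choose A hA using hc
  obtain ⟨B, hB⟩ := exists_generalized_inverse (Matrix.of A)
  set A' : Matrix (Fin l) (Fin n) ℚ := Matrix.of A with hA'
  set M : Matrix (Fin n) (Fin n) ℚ := 1 - B * A' with hM
  have hAM : A' * M = 0 := by
    rw [hM, Matrix.mul_sub, ← Matrix.mul_assoc, hB, Matrix.mul_one, sub_self]
  let MR : Matrix (Fin n) (Fin n) ℝ := M.map (Rat.castHom ℝ)
  let AR : Matrix (Fin l) (Fin n) ℝ := A'.map (Rat.castHom ℝ)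
  let BR : Matrix (Fin n) (Fin l) ℝ := B.map (Rat.castHom ℝ)
  have hMR : MR = 1 - BR * AR := by
    have : (Rat.castHom ℝ).mapMatrix M = (1 : Matrix (Fin n) (Fin n) ℝ) - BR * AR := by
      rw [hM, map_sub, map_one]
      congr 1
      exact Matrix.map_mul
    exact this
  have hAR : ∀ i, AR i = c i := by
    intro i
    ext j
    simp [AR, hA', hA]
  let x : Fin n → ℝ := fun j => φ₀ (Pi.single j 1)
  have hx : ∀ w, φ₀ w = x ⬝ᵥ w := by
    intro w
    conv_lhs => rw [pi_eq_sum_univ' w]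
    simp only [map_sum, map_smul, dotProduct, smul_eq_mul, x]
    refine Finset.sum_congr rfl fun j _ => ?_
    rw [mul_comm]
  have hAx : AR.mulVec x = 0 := by
    ext i
    have := hφ₀c i
    rw [hx, dotProduct_comm, ← hAR] at this
    exact this
  have hMx : MR.mulVec x = x := by
    rw [hMR, Matrix.sub_mulVec, Matrix.one_mulVec, ← Matrix.mulVec_mulVec, hAx,
      Matrix.mulVec_zero, sub_zero]
  have hK : IsCompact (W ∩ Metric.sphere 0 1) := (isCompact_sphere _ _).inter_left hWclosed
  have hev : ∀ᶠ y in nhds x, ∀ w ∈ W ∩ Metric.sphere 0 1, 0 < (MR.mulVec y) ⬝ᵥ w := by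
    apply hK.eventually_forall_of_forall_eventually
    rintro w ⟨hw, hw1⟩
    have hcont : Continuous fun z : (Fin n → ℝ) × (Fin n → ℝ) => (MR.mulVec z.1) ⬝ᵥ z.2 := by
      fun_prop
    refine hcont.continuousAt.eventually (lt_mem_nhds ?_)
    simp only [hMx]
    rw [← hx]
    exact hφ₀W w hw (Metric.ne_of_mem_sphere hw1 one_ne_zero)
  have hd : DenseRange (Pi.map fun (_ : Fin n) (q : ℚ) => (q : ℝ)) :=
    DenseRange.piMap fun _ => Rat.denseRange_cast
  obtain ⟨_, hy, q, rfl⟩ := mem_closure_iff_nhds.mp (hd x) _ hev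
  simp only [Set.mem_ofPred_eq] at hy
  have hval : ∀ j, MR.mulVec (Pi.map (fun (_ : Fin n) (q : ℚ) => (q : ℝ)) q) j
      = ((M.mulVec q j : ℚ) : ℝ) := by
    intro j
    simp [Matrix.mulVec, dotProduct, MR]
  set y : Fin n → ℝ := Pi.map (fun (_ : Fin n) (q : ℚ) => (q : ℝ)) q with hyq
  refine ⟨dotProductBilin ℝ ℝ (MR.mulVec y), ?_, ?_, ?_⟩
  · intro j
    refine ⟨M.mulVec q j, ?_⟩
    rw [← hval]
    simp
  · intro i
    have h0 : AR * MR = 0 := by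
      rw [← Matrix.map_mul, hAM]
      ext; simp
    have : AR.mulVec (MR.mulVec y) i = 0 := by
      rw [Matrix.mulVec_mulVec, h0, Matrix.zero_mulVec, Pi.zero_apply]
    change MR.mulVec y ⬝ᵥ c i = 0
    rw [dotProduct_comm, ← hAR]
    exact this
  · intro w hw hw0
    change 0 < MR.mulVec y ⬝ᵥ w
    have hn : 0 < ‖w‖ := norm_pos_iff.mpr hw0
    have := hy (‖w‖⁻¹ • w) ⟨hWcone _ (by positivity) w hw, by
      simp [norm_smul, hn.ne']⟩
    rw [dotProduct_smul, smul_eq_mul] at this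
    exact (mul_pos_iff_of_pos_left (inv_pos.mpr hn)).mp this
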